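/- Linear convergence of TMA with geometrically increasing step sizes: assume min_s ρ_s > 0, fix a policy π ∈ Π, let p* ∈ argmax_{p∈𝒫} J_ρ(π,p), and let (p_t) be the TMA iterates with step sizes satisfying β_0 > 0 and (1 − (1−γ)/M) β_t ≥ β_{t−1} for all t ≥ 1. Then for every t ≥ 0: J_ρ(π,p*) − J_ρ(π,p_t) ≤ (1 − (1−γ)/M)^t · ( J_ρ(π,p*) − J_ρ(π,p_0) + B_{d^{π,p*}_ρ}(p*, p_0) / ((M − 1 + γ) β_0) ). -/

import Mathlib

open scoped BigOperators

noncomputable section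

namespace RMDPStmt

variable {S A : ℕ}

/-- `p` is a transition kernel: each `p s a` lies in the probability simplex `Δ^S`. -/
def IsKernel (p : Fin S → Fin A → Fin S → ℝ) : Prop :=
  ∀ s a, p s a ∈ stdSimplex ℝ (Fin S)

/-- `π` is a stationary randomized policy: each `π s` lies in the simplex `Δ^A`. -/
def IsPolicy (π : Fin S → Fin A → ℝ) : Prop :=
  ∀ s, π s ∈ stdSimplex ℝ (Fin A)

/-- The state-to-state matrix `P^π`. -/
def Pmat (π : Fin S → Fin A → ℝ) (p : Fin S → Fin A → Fin S → ℝ) :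
    Matrix (Fin S) (Fin S) ℝ :=
  Matrix.of fun s s' => ∑ a, π s a * p s a s'

/-- The expected one-step cost vector `c^π`. -/
def cvec (c : Fin S → Fin A → Fin S → ℝ) (π : Fin S → Fin A → ℝ)
    (p : Fin S → Fin A → Fin S → ℝ) : Fin S → ℝ :=
  fun s => ∑ a, π s a * ∑ s', p s a s' * c s a s'

/-- Value function `v^{π,p}` as a discounted series. -/
def value (γ : ℝ) (c : Fin S → Fin A → Fin S → ℝ) (π : Fin S → Fin A → ℝ)
    (p : Fin S → Fin A → Fin S → ℝ) : Fin S → ℝ :=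
  fun s => ∑' t : ℕ, γ ^ t * ((Pmat π p ^ t).mulVec (cvec c π p)) s

/-- The return `J_ρ(π,p)`. -/
def J (γ : ℝ) (c : Fin S → Fin A → Fin S → ℝ) (ρ : Fin S → ℝ)
    (π : Fin S → Fin A → ℝ) (p : Fin S → Fin A → Fin S → ℝ) : ℝ :=
  ∑ s, ρ s * value γ c π p s

/-- The action-value function `q^{π,p}`. -/
def qval (γ : ℝ) (c : Fin S → Fin A → Fin S → ℝ) (π : Fin S → Fin A → ℝ)
    (p : Fin S → Fin A → Fin S → ℝ) : Fin S → Fin A → ℝ :=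
  fun s a => ∑ s', p s a s' * (c s a s' + γ * value γ c π p s')

/-- The discounted state occupancy measure `d^{π,p}_ρ`. -/
def occ (γ : ℝ) (ρ : Fin S → ℝ) (π : Fin S → Fin A → ℝ)
    (p : Fin S → Fin A → Fin S → ℝ) : Fin S → ℝ :=
  fun s' => (1 - γ) * ∑' t : ℕ, γ ^ t * ∑ s, ρ s * (Pmat π p ^ t) s s'

/-- Bregman divergence generated by `h`. -/
def breg {E : Type*} [NormedAddCommGroup E] [NormedSpace ℝ E]
    (h : E → ℝ) (x y : E) : ℝ :=
  h x - h y - fderiv ℝ h y (x - y)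

/-- Weighted Bregman divergence `B_μ`. -/
def bregW {E : Type*} [NormedAddCommGroup E] [NormedSpace ℝ E]
    (μ : Fin S → ℝ) (h : E → ℝ) (x y : Fin S → E) : ℝ :=
  ∑ s, μ s * breg h (x s) (y s)

/-- Inner product of two action-indexed vectors. -/
def dotA (u v : Fin A → ℝ) : ℝ := ∑ a, u a * v a

/-- Inner product of two action-by-state arrays. -/
def dotAS (u v : Fin A → Fin S → ℝ) : ℝ := ∑ a, ∑ s', u a s' * v a s'

/-- The robust objective `Φ(π) = sup_{p ∈ Amb} J_ρ(π,p)`. -/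
def Phi (γ : ℝ) (c : Fin S → Fin A → Fin S → ℝ) (ρ : Fin S → ℝ)
    (Amb : Set (Fin S → Fin A → Fin S → ℝ)) (π : Fin S → Fin A → ℝ) : ℝ :=
  sSup ((fun p => J γ c ρ π p) '' Amb)

/-- The distribution mismatch coefficient
`M = sup_{π ∈ Π, p ∈ Amb} max_s d^{π,p}_ρ(s)/ρ_s`. -/
def mismatch (γ : ℝ) (ρ : Fin S → ℝ)
    (Amb : Set (Fin S → Fin A → Fin S → ℝ)) : ℝ :=
  sSup {x : ℝ | ∃ (π : Fin S → Fin A → ℝ) (p : Fin S → Fin A → Fin S → ℝ),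
    IsPolicy π ∧ p ∈ Amb ∧ ∃ s, x = occ γ ρ π p s / ρ s}


/-- The array `ĝ^{π,p}_s ∈ ℝ^{A×S}` with `(ĝ^{π,p}_s)_{as'} = π_{sa}(c_{sas'} + γ v^{π,p}_{s'})`. -/
def ghat {S A : ℕ} (γ : ℝ) (c : Fin S → Fin A → Fin S → ℝ)
    (π : Fin S → Fin A → ℝ) (p : Fin S → Fin A → Fin S → ℝ) (s : Fin S) :
    Fin A → Fin S → ℝ :=
  fun a s' => π s a * (c s a s' + γ * value γ c π p s')

section Bregman

variable {E : Type*} [NormedAddCommGroup E] [NormedSpace ℝ E] {h : E → ℝ} {x y z : E}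

/-- The Bregman divergence of a differentiable convex function is nonnegative. -/
lemma breg_nonneg (hconv : ConvexOn ℝ Set.univ h) (hdiff : DifferentiableAt ℝ h y) :
    0 ≤ breg h x y := by
  have hg : ConvexOn ℝ Set.univ (h ∘ AffineMap.lineMap (k := ℝ) y x) :=
    hconv.comp_affineMap (AffineMap.lineMap (k := ℝ) y x)
  have hline : HasDerivAt (AffineMap.lineMap (k := ℝ) y x) (x - y) (0 : ℝ) :=
    AffineMap.hasDerivAt_lineMap
  have hderiv : HasDerivAt (h ∘ AffineMap.lineMap (k := ℝ) y x) (fderiv ℝ h y (x - y)) 0 := by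
    refine HasFDerivAt.comp_hasDerivAt (0 : ℝ) ?_ hline
    simpa using hdiff.hasFDerivAt
  have := hg.le_slope_of_hasDerivAt (Set.mem_univ 0) (Set.mem_univ 1) one_pos hderiv
  simp only [slope_def_field, Function.comp_apply, AffineMap.lineMap_apply_one,
    AffineMap.lineMap_apply_zero, sub_zero, div_one] at this
  unfold breg
  linarith

/-- The three-point inequality for a Bregman proximal step over a convex set. -/
lemma three_point_inequality (hdiff : Differentiable ℝ h) {C : Set E} (hC : Convex ℝ C)
    (L : E →L[ℝ] ℝ) (hz : z ∈ C)
    (hmax : ∀ w ∈ C, L w - breg h w y ≤ L z - breg h z y) (hx : x ∈ C) :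
    L x - breg h x y + breg h x z ≤ L z - breg h z y := by
  have hbreg : HasFDerivAt (fun w => breg h w y) (fderiv ℝ h z - fderiv ℝ h y) z := by
    unfold breg
    exact ((hdiff z).hasFDerivAt.sub_const (h y)).sub
      ((fderiv ℝ h y).hasFDerivAt.comp z ((hasFDerivAt_id z).sub_const y))
  have hopt := IsLocalMaxOn.hasFDerivWithinAt_nonpos
    (IsMaxOn.localize (show IsMaxOn (fun w => L w - breg h w y) C z from hmax))
    (L.hasFDerivAt.sub hbreg).hasFDerivWithinAt
    (sub_mem_posTangentConeAt_of_segment_subset (hC.segment_subset hz hx))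
  simp only [sub_apply, map_sub] at hopt
  simp only [breg, map_sub]
  linarith

end Bregman

/-- The pairing `dotAS u` as a continuous linear functional. -/
def dotASL (u : Fin A → Fin S → ℝ) : (Fin A → Fin S → ℝ) →L[ℝ] ℝ :=
  LinearMap.toContinuousLinearMap
    { toFun := dotAS u
      map_add' := fun v w => by simp [dotAS, mul_add, Finset.sum_add_distrib]
      map_smul' := fun r v => by simp [dotAS, Finset.mul_sum, mul_left_comm] }

lemma dotASL_apply (u v : Fin A → Fin S → ℝ) : dotASL u v = dotAS u v := rfl

lemma Pmat_mem_rowStochastic {π : Fin S → Fin A → ℝ} {p : Fin S → Fin A → Fin S → ℝ}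
    (hπ : IsPolicy π) (hp : IsKernel p) : Pmat π p ∈ Matrix.rowStochastic ℝ (Fin S) := by
  rw [Matrix.mem_rowStochastic_iff_sum]
  simp only [Pmat, Matrix.of_apply]
  refine ⟨fun s s' => Finset.sum_nonneg fun a _ => mul_nonneg ((hπ s).1 a) ((hp s a).1 s'),
    fun s => ?_⟩
  rw [Finset.sum_comm]
  simp only [← Finset.mul_sum, (hp s _).2, mul_one, (hπ s).2]

section Discounted

variable {γ : ℝ} {P : Matrix (Fin S) (Fin S) ℝ}

lemma summable_discounted_pow_apply (hγ : γ ∈ Set.Ioo (0 : ℝ) 1)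
    (hP : P ∈ Matrix.rowStochastic ℝ (Fin S)) (s s' : Fin S) :
    Summable fun t : ℕ => γ ^ t * (P ^ t) s s' := by
  refine Summable.of_nonneg_of_le (fun t => ?_) (fun t => ?_)
    (summable_geometric_of_lt_one hγ.1.le hγ.2)
  · exact mul_nonneg (pow_nonneg hγ.1.le t) (Matrix.nonneg_of_mem_rowStochastic (pow_mem hP t))
  · exact mul_le_of_le_one_right (pow_nonneg hγ.1.le t)
      (Matrix.le_one_of_mem_rowStochastic (pow_mem hP t))

lemma summable_discounted_mulVec (hγ : γ ∈ Set.Ioo (0 : ℝ) 1)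
    (hP : P ∈ Matrix.rowStochastic ℝ (Fin S)) (u : Fin S → ℝ) (s : Fin S) :
    Summable fun t : ℕ => γ ^ t * ((P ^ t).mulVec u) s := by
  have : Summable fun t : ℕ => ∑ s', γ ^ t * (P ^ t) s s' * u s' :=
    summable_sum fun s' _ => (summable_discounted_pow_apply hγ hP s s').mul_right _
  refine this.congr fun t => ?_
  simp only [Matrix.mulVec, dotProduct, Finset.mul_sum, mul_assoc]

lemma summable_discounted_vecMul (hγ : γ ∈ Set.Ioo (0 : ℝ) 1)
    (hP : P ∈ Matrix.rowStochastic ℝ (Fin S)) (u : Fin S → ℝ) (s' : Fin S) :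
    Summable fun t : ℕ => γ ^ t * ∑ s, u s * (P ^ t) s s' := by
  have : Summable fun t : ℕ => ∑ s, γ ^ t * (P ^ t) s s' * u s :=
    summable_sum fun s _ => (summable_discounted_pow_apply hγ hP s s').mul_right _
  refine this.congr fun t => ?_
  rw [Finset.mul_sum]
  exact Finset.sum_congr rfl fun s _ => by ring

end Discounted

section MDP

variable {γ : ℝ} {c : Fin S → Fin A → Fin S → ℝ} {ρ : Fin S → ℝ} {π : Fin S → Fin A → ℝ}
  {p q : Fin S → Fin A → Fin S → ℝ}

/-- The Bellman equation for the value function. -/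
lemma value_eq (hγ : γ ∈ Set.Ioo (0 : ℝ) 1) (hπ : IsPolicy π) (hp : IsKernel p) (s : Fin S) :
    value γ c π p s = cvec c π p s + γ * ∑ s', Pmat π p s s' * value γ c π p s' := by
  have hsum := summable_discounted_mulVec hγ (Pmat_mem_rowStochastic hπ hp) (cvec c π p)
  unfold value
  rw [(hsum s).tsum_eq_zero_add]
  congr 1
  · simp
  · simp_rw [← tsum_mul_left]
    rw [← Summable.tsum_finsetSum fun s' _ => (hsum s').mul_left _, ← tsum_mul_left]
    refine tsum_congr fun t => ?_
    rw [pow_succ' (Pmat π p), ← Matrix.mulVec_mulVec]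
    simp only [Matrix.mulVec, dotProduct, Finset.mul_sum]
    refine Finset.sum_congr rfl fun s' _ => Finset.sum_congr rfl fun s'' _ => ?_
    ring

/-- The flow equation for the occupancy measure. -/
lemma occ_eq (hγ : γ ∈ Set.Ioo (0 : ℝ) 1) (hπ : IsPolicy π) (hp : IsKernel p) (s' : Fin S) :
    occ γ ρ π p s' = (1 - γ) * ρ s' + γ * ∑ s, occ γ ρ π p s * Pmat π p s s' := by
  have hsum := summable_discounted_vecMul hγ (Pmat_mem_rowStochastic hπ hp) ρ
  have hstep : ∑' t : ℕ, γ ^ (t + 1) * ∑ s, ρ s * (Pmat π p ^ (t + 1)) s s' =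
      γ * ∑ r, (∑' t : ℕ, γ ^ t * ∑ s, ρ s * (Pmat π p ^ t) s r) * Pmat π p r s' := by
    simp_rw [← tsum_mul_right]
    rw [← Summable.tsum_finsetSum fun r _ => (hsum r).mul_right _, ← tsum_mul_left]
    refine tsum_congr fun t => ?_
    simp only [pow_succ (Pmat π p), Matrix.mul_apply, Finset.mul_sum, Finset.sum_mul]
    rw [Finset.sum_comm]
    refine Finset.sum_congr rfl fun r _ => Finset.sum_congr rfl fun s _ => ?_
    ring
  unfold occ
  rw [(hsum s').tsum_eq_zero_add, hstep]
  simp only [mul_assoc, ← Finset.mul_sum]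
  simp [Matrix.one_apply]
  ring

lemma occ_nonneg (hγ : γ ∈ Set.Ioo (0 : ℝ) 1) (hρ : ∀ s, 0 ≤ ρ s) (hπ : IsPolicy π)
    (hp : IsKernel p) (s : Fin S) : 0 ≤ occ γ ρ π p s :=
  mul_nonneg (sub_nonneg.2 hγ.2.le) <| tsum_nonneg fun t => mul_nonneg (pow_nonneg hγ.1.le t) <|
    Finset.sum_nonneg fun r _ => mul_nonneg (hρ r) <|
      Matrix.nonneg_of_mem_rowStochastic (pow_mem (Pmat_mem_rowStochastic hπ hp) t)

lemma le_occ (hγ : γ ∈ Set.Ioo (0 : ℝ) 1) (hρ : ∀ s, 0 ≤ ρ s) (hπ : IsPolicy π)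
    (hp : IsKernel p) (s : Fin S) : (1 - γ) * ρ s ≤ occ γ ρ π p s := by
  rw [occ_eq hγ hπ hp s]
  refine le_add_of_nonneg_right <| mul_nonneg hγ.1.le <| Finset.sum_nonneg fun r _ => ?_
  exact mul_nonneg (occ_nonneg hγ hρ hπ hp r)
    (Matrix.nonneg_of_mem_rowStochastic (Pmat_mem_rowStochastic hπ hp))

lemma occ_le_one (hγ : γ ∈ Set.Ioo (0 : ℝ) 1) (hρ : ρ ∈ stdSimplex ℝ (Fin S)) (hπ : IsPolicy π)
    (hp : IsKernel p) (s : Fin S) : occ γ ρ π p s ≤ 1 := by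
  have hP := Pmat_mem_rowStochastic hπ hp
  have hle : ∑' t : ℕ, γ ^ t * ∑ r, ρ r * (Pmat π p ^ t) r s ≤ ∑' t : ℕ, γ ^ t := by
    refine (summable_discounted_vecMul hγ hP ρ s).tsum_le_tsum (fun t => ?_)
      (summable_geometric_of_lt_one hγ.1.le hγ.2)
    refine mul_le_of_le_one_right (pow_nonneg hγ.1.le t) ?_
    rw [← hρ.2]
    exact Finset.sum_le_sum fun r _ => mul_le_of_le_one_right (hρ.1 r)
      (Matrix.le_one_of_mem_rowStochastic (pow_mem hP t))
  rw [tsum_geometric_of_lt_one hγ.1.le hγ.2] at hle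
  have hpos : 0 < 1 - γ := sub_pos.2 hγ.2
  calc occ γ ρ π p s ≤ (1 - γ) * (1 - γ)⁻¹ := mul_le_mul_of_nonneg_left hle hpos.le
    _ = 1 := mul_inv_cancel₀ (ne_of_gt hpos)

/-- The one-step lookahead of the value function of `p` under the kernel `q`. -/
lemma dotAS_ghat (s : Fin S) :
    dotAS (ghat γ c π p s) (q s) =
      cvec c π q s + γ * ∑ s', Pmat π q s s' * value γ c π p s' := by
  simp only [dotAS, ghat, cvec, Pmat, Matrix.of_apply, Finset.mul_sum, Finset.sum_mul]
  rw [Finset.sum_comm (f := fun s' a => γ * (π s a * q s a s' * value γ c π p s')),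
    ← Finset.sum_add_distrib]
  refine Finset.sum_congr rfl fun a _ => ?_
  rw [← Finset.sum_add_distrib]
  exact Finset.sum_congr rfl fun s' _ => by ring

/-- The performance difference lemma for two kernels under a fixed policy. -/
lemma performance_difference (hγ : γ ∈ Set.Ioo (0 : ℝ) 1) (hπ : IsPolicy π)
    (hp : IsKernel p) (hq : IsKernel q) :
    (1 - γ) * (J γ c ρ π q - J γ c ρ π p) =
      ∑ s, occ γ ρ π q s *
        (dotAS (ghat γ c π p s) (q s) - dotAS (ghat γ c π p s) (p s)) := by
  set u : Fin S → ℝ := fun s => value γ c π q s - value γ c π p s with hu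
  have hδ : ∀ s, dotAS (ghat γ c π p s) (q s) - dotAS (ghat γ c π p s) (p s) =
      u s - γ * ∑ s', Pmat π q s s' * u s' := by
    intro s
    rw [dotAS_ghat, dotAS_ghat, ← value_eq hγ hπ hp s]
    simp only [hu, mul_sub, Finset.sum_sub_distrib]
    linarith [value_eq (c := c) hγ hπ hq s]
  have hflow : ∑ s, occ γ ρ π q s * (γ * ∑ s', Pmat π q s s' * u s') =
      ∑ s', γ * (∑ s, occ γ ρ π q s * Pmat π q s s') * u s' := by
    simp only [Finset.mul_sum, Finset.sum_mul]
    rw [Finset.sum_comm]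
    exact Finset.sum_congr rfl fun s' _ => Finset.sum_congr rfl fun s _ => by ring
  simp only [hδ]
  simp only [mul_sub (occ γ ρ π q _), Finset.sum_sub_distrib, hflow]
  rw [← Finset.sum_sub_distrib]
  simp only [J]
  rw [← Finset.sum_sub_distrib, Finset.mul_sum]
  refine Finset.sum_congr rfl fun s _ => ?_
  have := occ_eq (ρ := ρ) hγ hπ hq s
  simp only [hu]
  linear_combination (-(value γ c π q s - value γ c π p s)) * this

end MDP

section Mismatch

variable {γ : ℝ} {ρ : Fin S → ℝ} {Amb : Set (Fin S → Fin A → Fin S → ℝ)}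
  {π : Fin S → Fin A → ℝ} {p : Fin S → Fin A → Fin S → ℝ}

lemma occ_le_mismatch_mul (hγ : γ ∈ Set.Ioo (0 : ℝ) 1) (hρ : ρ ∈ stdSimplex ℝ (Fin S))
    (hρpos : ∀ s, 0 < ρ s) (hAmb : ∀ q ∈ Amb, IsKernel q) (hπ : IsPolicy π) (hp : p ∈ Amb)
    (s : Fin S) : occ γ ρ π p s ≤ mismatch γ ρ Amb * ρ s := by
  rw [← div_le_iff₀ (hρpos s)]
  refine le_csSup ⟨∑ r, 1 / ρ r, ?_⟩ ⟨π, p, hπ, hp, s, rfl⟩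
  rintro x ⟨π', p', hπ', hp', r, rfl⟩
  calc occ γ ρ π' p' r / ρ r ≤ 1 / ρ r :=
        div_le_div_of_nonneg_right (occ_le_one hγ hρ hπ' (hAmb p' hp') r) (hρpos r).le
    _ ≤ ∑ r, 1 / ρ r := Finset.single_le_sum (f := fun r => 1 / ρ r)
        (fun r _ => (one_div_pos.2 (hρpos r)).le) (Finset.mem_univ r)

lemma mismatch_pos (hS : 0 < S) (hγ : γ ∈ Set.Ioo (0 : ℝ) 1) (hρ : ρ ∈ stdSimplex ℝ (Fin S))
    (hρpos : ∀ s, 0 < ρ s) (hAmb : ∀ q ∈ Amb, IsKernel q) (hπ : IsPolicy π) (hp : p ∈ Amb) :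
    0 < mismatch γ ρ Amb := by
  have hle := (le_occ hγ hρ.1 hπ (hAmb p hp) ⟨0, hS⟩).trans
    (occ_le_mismatch_mul hγ hρ hρpos hAmb hπ hp ⟨0, hS⟩)
  exact (sub_pos.2 hγ.2).trans_le (le_of_mul_le_mul_right hle (hρpos _))

end Mismatch

/-- A perturbed contraction `M Δ_{t+1} ≤ M α Δ_t + (D_t - D_{t+1}) / β_t`, written without
division, with geometrically increasing steps forces geometric decay of `Δ`. -/
lemma geometric_decay_of_telescoping {M α : ℝ} (hM : 0 < M) (hα : 0 < α) {β Δ D : ℕ → ℝ}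
    (hβpos : ∀ t, 0 < β t) (hβstep : ∀ t, β t ≤ α * β (t + 1)) (hD : ∀ t, 0 ≤ D t)
    (hrec : ∀ t, β t * (M * Δ (t + 1)) ≤ β t * (M * (α * Δ t)) + (D t - D (t + 1))) (t : ℕ) :
    Δ t ≤ α ^ t * (Δ 0 + D 0 / (M * α * β 0)) := by
  have key : ∀ t, Δ t + D t / (M * α * β t) ≤ α ^ t * (Δ 0 + D 0 / (M * α * β 0)) := by
    intro t
    induction t with
    | zero => simp
    | succ t ih =>
      have hMβ : 0 < M * β t := mul_pos hM (hβpos t)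
      have hshrink : D (t + 1) / (M * α * β (t + 1)) ≤ D (t + 1) / (M * β t) := by
        refine div_le_div_of_nonneg_left (hD _) hMβ ?_
        rw [mul_assoc]
        exact mul_le_mul_of_nonneg_left (hβstep t) hM.le
      have hstep : Δ (t + 1) + D (t + 1) / (M * β t) ≤ α * (Δ t + D t / (M * α * β t)) := by
        have hβ := (hβpos t).ne'
        have hdiv : Δ (t + 1) + D (t + 1) / (M * β t) =
            (β t * (M * Δ (t + 1)) + D (t + 1)) / (M * β t) := by
          field_simp
        have hdiv' : α * (Δ t + D t / (M * α * β t)) =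
            (β t * (M * (α * Δ t)) + D t) / (M * β t) := by
          field_simp
        rw [hdiv, hdiv']
        exact div_le_div_of_nonneg_right (by linarith [hrec t]) hMβ.le
      calc Δ (t + 1) + D (t + 1) / (M * α * β (t + 1))
          ≤ α * (Δ t + D t / (M * α * β t)) := by linarith
        _ ≤ α * (α ^ t * (Δ 0 + D 0 / (M * α * β 0))) := mul_le_mul_of_nonneg_left ih hα.le
        _ = α ^ (t + 1) * (Δ 0 + D 0 / (M * α * β 0)) := by ring
  have hnonneg : 0 ≤ D t / (M * α * β t) :=
    div_nonneg (hD t) (mul_pos (mul_pos hM hα) (hβpos t)).le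
  linarith [key t]

/-- Linear convergence of TMA with geometrically increasing step sizes. -/
theorem tma_linear_convergence
    {S A : ℕ} (hS : 0 < S) (hA : 0 < A)
    (γ : ℝ) (hγ : γ ∈ Set.Ioo (0 : ℝ) 1)
    (c : Fin S → Fin A → Fin S → ℝ)
    (hc : ∀ s a s', c s a s' ∈ Set.Icc (0 : ℝ) 1)
    (ρ : Fin S → ℝ) (hρ : ρ ∈ stdSimplex ℝ (Fin S)) (hρpos : ∀ s, 0 < ρ s)
    -- s-rectangular ambiguity set
    (Ps : Fin S → Set (Fin A → Fin S → ℝ))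
    (hPsne : ∀ s, (Ps s).Nonempty) (hPscpt : ∀ s, IsCompact (Ps s))
    (hPsconv : ∀ s, Convex ℝ (Ps s))
    (hPssub : ∀ s, ∀ x ∈ Ps s, ∀ a, x a ∈ stdSimplex ℝ (Fin S))
    (Amb : Set (Fin S → Fin A → Fin S → ℝ))
    (hAmb : Amb = {p | ∀ s, p s ∈ Ps s})
    -- fixed policy
    (π : Fin S → Fin A → ℝ) (hπ : IsPolicy π)
    -- Bregman generating function
    (h : (Fin A → Fin S → ℝ) → ℝ) (hh : ContDiff ℝ 1 h)
    (hhconv : StrictConvexOn ℝ Set.univ h)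
    -- worst-case transition kernel p⋆ ∈ argmax_{p ∈ Amb} J_ρ(π,p)
    (ps : Fin S → Fin A → Fin S → ℝ) (hps : ps ∈ Amb)
    (hpsmax : ∀ q ∈ Amb, J γ c ρ π q ≤ J γ c ρ π ps)
    -- TMA iterates, step sizes β_0 > 0 and (1 - (1-γ)/M) β_t ≥ β_{t-1}
    (β : ℕ → ℝ) (hβpos : ∀ t, 0 < β t)
    (hβstep : ∀ t : ℕ,
      β t ≤ (1 - (1 - γ) / mismatch γ ρ Amb) * β (t + 1))
    (p : ℕ → Fin S → Fin A → Fin S → ℝ) (hp : ∀ t s, p t s ∈ Ps s)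
    (hupd : ∀ t s, ∀ x ∈ Ps s,
      β t * dotAS (ghat γ c π (p t) s) x - breg h x (p t s) ≤
        β t * dotAS (ghat γ c π (p t) s) (p (t + 1) s) -
          breg h (p (t + 1) s) (p t s)) :
    ∀ t : ℕ,
      J γ c ρ π ps - J γ c ρ π (p t) ≤
        (1 - (1 - γ) / mismatch γ ρ Amb) ^ t *
          (J γ c ρ π ps - J γ c ρ π (p 0)
            + bregW (occ γ ρ π ps) h ps (p 0) /
                ((mismatch γ ρ Amb - 1 + γ) * β 0)) := by
  set M := mismatch γ ρ Amb with hMdef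
  have hker : ∀ q ∈ Amb, IsKernel q := by
    intro q hq s a
    rw [hAmb] at hq
    exact hPssub s (q s) (hq s) a
  have hpsPs : ∀ s, ps s ∈ Ps s := by rwa [hAmb] at hps
  have hpK : ∀ t, IsKernel (p t) := fun t s a => hPssub s _ (hp t s) a
  have hM : 0 < M := mismatch_pos hS hγ hρ hρpos hker hπ hps
  have hα : 0 < 1 - (1 - γ) / M :=
    pos_of_mul_pos_left ((hβpos 0).trans_le (hβstep 0)) (hβpos 1).le
  have hMα : M * (1 - (1 - γ) / M) = M - 1 + γ := by
    field_simp
    ring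
  have hdiff : Differentiable ℝ h := hh.differentiable one_ne_zero
  have hB : ∀ x y, 0 ≤ breg h x y := fun x y => breg_nonneg hhconv.convexOn (hdiff y)
  have hd := occ_nonneg hγ hρ.1 hπ (hker ps hps)
  have hD : ∀ t, 0 ≤ bregW (occ γ ρ π ps) h ps (p t) := fun t =>
    Finset.sum_nonneg fun s _ => mul_nonneg (hd s) (hB _ _)
  rw [← hMα]
  refine geometric_decay_of_telescoping (Δ := fun t => J γ c ρ π ps - J γ c ρ π (p t))
    (D := fun t => bregW (occ γ ρ π ps) h ps (p t)) hM hα hβpos hβstep hD fun t => ?_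
  set δ : Fin S → ℝ := fun s => dotAS (ghat γ c π (p t) s) (p (t + 1) s) -
    dotAS (ghat γ c π (p t) s) (p t s) with hδ
  have hδ_nonneg : ∀ s, 0 ≤ δ s := by
    intro s
    have hself := hupd t s _ (hp t s)
    have hzero : breg h (p t s) (p t s) = 0 := by simp [breg]
    have : 0 ≤ β t * δ s := by
      simp only [hδ, mul_sub]
      linarith [hB (p (t + 1) s) (p t s)]
    exact nonneg_of_mul_nonneg_right this (hβpos t)
  have hprox : ∀ s, β t * (dotAS (ghat γ c π (p t) s) (ps s) -
      dotAS (ghat γ c π (p t) s) (p t s)) ≤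
        β t * δ s + (breg h (ps s) (p t s) - breg h (ps s) (p (t + 1) s)) := by
    intro s
    have h3 := three_point_inequality hdiff (hPsconv s)
      (β t • dotASL (ghat γ c π (p t) s)) (hp (t + 1) s)
      (by simpa [dotASL_apply] using hupd t s) (hpsPs s)
    simp only [smul_apply, dotASL_apply, smul_eq_mul] at h3
    simp only [hδ, mul_sub]
    linarith [hB (p (t + 1) s) (p t s)]
  have hgap : β t * ((1 - γ) * (J γ c ρ π ps - J γ c ρ π (p t))) ≤
      β t * ∑ s, occ γ ρ π ps s * δ s +
        (bregW (occ γ ρ π ps) h ps (p t) - bregW (occ γ ρ π ps) h ps (p (t + 1))) := by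
    rw [performance_difference hγ hπ (hpK t) (hker ps hps)]
    simp only [bregW, Finset.mul_sum]
    rw [← Finset.sum_sub_distrib, ← Finset.sum_add_distrib]
    refine Finset.sum_le_sum fun s _ => ?_
    linarith [mul_le_mul_of_nonneg_left (hprox s) (hd s)]
  have hprogress : ∑ s, ρ s * δ s ≤ J γ c ρ π (p (t + 1)) - J γ c ρ π (p t) := by
    refine le_of_mul_le_mul_left ?_ (sub_pos.2 hγ.2)
    rw [performance_difference hγ hπ (hpK t) (hpK (t + 1)), Finset.mul_sum]
    refine Finset.sum_le_sum fun s _ => ?_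
    rw [← mul_assoc]
    exact mul_le_mul_of_nonneg_right (le_occ hγ hρ.1 hπ (hpK (t + 1)) s) (hδ_nonneg s)
  have hmis : ∑ s, occ γ ρ π ps s * δ s ≤
      M * (J γ c ρ π (p (t + 1)) - J γ c ρ π (p t)) := by
    refine le_trans ?_ (mul_le_mul_of_nonneg_left hprogress hM.le)
    rw [Finset.mul_sum]
    refine Finset.sum_le_sum fun s _ => ?_
    rw [← mul_assoc]
    exact mul_le_mul_of_nonneg_right
      (occ_le_mismatch_mul hγ hρ hρpos hker hπ hps s) (hδ_nonneg s)
  have hscaled := mul_le_mul_of_nonneg_left hmis (hβpos t).le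
  rw [← mul_assoc M (1 - (1 - γ) / M), hMα]
  linarith

end RMDPStmt
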